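/- Fix x, y in R^3 with x_3 > 0 > y_3 and fix mu >= 1. For s > 0, define G_s = (1/(2*pi)^2) * Integral over (u,v) in R^2 of (gamma_s(kappa) + mu*kappa)^{-1} * exp(-gamma_s(kappa)*x_3 + kappa*y_3 + i*(u*(x_1 - y_1) + v*(x_2 - y_2))) du dv, where kappa = sqrt(u^2 + v^2) and gamma_s(kappa) is the principal complex square root of kappa^2 - i*s. Then G_s converges, as s tends to 0 from above, to (2/(1 + mu)) * 1/(4*pi*||x - y||). In particular, for mu = 1 the limit is the free-space Laplace Green's function 1/(4*pi*||x - y||). -/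

import Mathlib

open MeasureTheory

lemma aux_mean {k : ℂ} (hk : ‖k‖ < 1) :
    ∫ θ in (-Real.pi)..Real.pi, (1 - k * Complex.exp (θ * Complex.I))⁻¹ = 2 * Real.pi := by
  have hd : DiffContOnCl ℂ (fun w : ℂ => (1 - k * w)⁻¹) (Metric.ball 0 |1|) := by
    apply DifferentiableOn.diffContOnCl
    intro w hw
    rw [abs_one, closure_ball _ one_ne_zero] at hw
    have hw' : ‖w‖ ≤ 1 := by simpa using hw
    have : 1 - k * w ≠ 0 := by
      intro h
      have h1 : ‖k * w‖ = 1 := by rw [← sub_eq_zero.mp h]; simp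
      rw [norm_mul] at h1
      nlinarith [norm_nonneg k, norm_nonneg w]
    apply DifferentiableAt.differentiableWithinAt
    fun_prop (disch := assumption)
  have h := hd.circleAverage
  rw [Real.circleAverage_eq_integral_add (-Real.pi)] at h
  rw [intervalIntegral.integral_comp_add_right
    (fun θ => (1 - k * circleMap 0 1 θ)⁻¹)] at h
  have e1 : (0:ℝ) + -Real.pi = -Real.pi := by ring
  have e2 : 2 * Real.pi + -Real.pi = Real.pi := by ring
  rw [e1, e2] at h
  simp only [circleMap, zero_add, Complex.ofReal_one, one_mul, mul_zero, sub_zero, inv_one,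
    Complex.real_smul] at h
  have hp : (Real.pi : ℂ) ≠ 0 := by exact_mod_cast Real.pi_ne_zero
  push_cast at h
  field_simp at h
  simpa using h

lemma aux_ne {k w : ℂ} (hk : ‖k‖ < 1) (hw : ‖w‖ = 1) : 1 - k * w ≠ 0 := by
  intro h
  have h1 : ‖k * w‖ = 1 := by rw [← sub_eq_zero.mp h]; simp
  rw [norm_mul, hw] at h1
  linarith

lemma aux_angle (a b z : ℝ) (hz : 0 < z) :
    ∫ θ in (-Real.pi)..Real.pi,
      ((z : ℂ) - Complex.I * ((a * Real.cos θ + b * Real.sin θ : ℝ) : ℂ))⁻¹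
      = ((2 * Real.pi / Real.sqrt (a ^ 2 + b ^ 2 + z ^ 2) : ℝ) : ℂ) := by
  set R := Real.sqrt (a ^ 2 + b ^ 2 + z ^ 2) with hR
  have hR2 : R ^ 2 = a ^ 2 + b ^ 2 + z ^ 2 := Real.sq_sqrt (by positivity)
  have hRpos : 0 < R := Real.sqrt_pos.mpr (by positivity)
  have hRz : 0 < R + z := by linarith
  set k₁ : ℂ := Complex.I * (a - b * Complex.I) / ((R + z : ℝ) : ℂ) with hk1
  set k₂ : ℂ := Complex.I * (a + b * Complex.I) / ((R + z : ℝ) : ℂ) with hk2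
  have key : a ^ 2 + b ^ 2 < (R + z) ^ 2 := by nlinarith
  have hn : ∀ c : ℝ, c ^ 2 = b ^ 2 → ‖Complex.I * (a + c * Complex.I) / ((R + z : ℝ) : ℂ)‖ < 1 := by
    intro c hc
    rw [norm_div, norm_mul, Complex.norm_I, one_mul, Complex.norm_real, Real.norm_of_nonneg hRz.le,
      div_lt_one hRz, Complex.norm_add_mul_I, hc]
    rw [Real.sqrt_lt' hRz]; exact key
  have hn1 : ‖k₁‖ < 1 := by
    have := hn (-b) (by ring)
    rw [hk1]; convert this using 3; push_cast; ring
  have hn2 : ‖k₂‖ < 1 := hn b rfl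
  have hne1 : ∀ θ : ℝ, 1 - k₁ * Complex.exp (θ * Complex.I) ≠ 0 := fun θ =>
    aux_ne hn1 (Complex.norm_exp_ofReal_mul_I θ)
  have hne2 : ∀ θ : ℝ, 1 - k₂ * Complex.exp ((-θ : ℝ) * Complex.I) ≠ 0 := fun θ =>
    aux_ne hn2 (Complex.norm_exp_ofReal_mul_I (-θ))
  have hRc : (R : ℂ) ≠ 0 := by exact_mod_cast hRpos.ne'
  have hRzc : (R : ℂ) + z ≠ 0 := by exact_mod_cast hRz.ne'
  have hR2c : (R : ℂ) ^ 2 = a ^ 2 + b ^ 2 + z ^ 2 := by exact_mod_cast hR2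
  have hpt : ∀ θ : ℝ, ((z : ℂ) - Complex.I * ((a * Real.cos θ + b * Real.sin θ : ℝ) : ℂ))⁻¹
      = (R : ℂ)⁻¹ * ((1 - k₁ * Complex.exp (θ * Complex.I))⁻¹
        + (1 - k₂ * Complex.exp ((-θ : ℝ) * Complex.I))⁻¹ - 1) := by
    intro θ
    have h1 := hne1 θ
    have h2 := hne2 θ
    set A := k₁ * Complex.exp (θ * Complex.I) with hA
    set B := k₂ * Complex.exp ((-θ : ℝ) * Complex.I) with hB
    have hI := Complex.I_sq
    have hcs : Complex.cos θ ^ 2 + Complex.sin θ ^ 2 = 1 := by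
      rw [add_comm]; exact Complex.sin_sq_add_cos_sq θ
    have hAB : A * B = -(a ^ 2 + b ^ 2) / ((R : ℂ) + z) ^ 2 := by
      have : Complex.exp (θ * Complex.I) * Complex.exp ((-θ : ℝ) * Complex.I) = 1 := by
        rw [← Complex.exp_add]; push_cast; simp
      calc A * B = k₁ * k₂ * (Complex.exp (θ * Complex.I) * Complex.exp ((-θ : ℝ) * Complex.I)) := by
            rw [hA, hB]; ring
        _ = _ := by
            rw [this, hk1, hk2]; push_cast; field_simp; ring_nf
            have h4 : Complex.I ^ 4 = 1 := Complex.I_pow_four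
            rw [h4, hI]; ring
    have hApB : A + B = 2 * Complex.I * (a * Complex.cos θ + b * Complex.sin θ) / ((R : ℂ) + z) := by
      rw [hA, hB, hk1, hk2, Complex.exp_mul_I, Complex.exp_mul_I]
      push_cast
      rw [Complex.cos_neg, Complex.sin_neg]
      field_simp
      linear_combination (-2 * b * Complex.sin θ) * hI
    have hprod : (1 - A) * (1 - B) = 2 / ((R : ℂ) + z) *
        (z - Complex.I * (a * Complex.cos θ + b * Complex.sin θ)) := by
      have : (1 - A) * (1 - B) = 1 - (A + B) + A * B := by ring
      rw [this, hAB, hApB]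
      field_simp
      linear_combination hR2c
    have hden : (z - Complex.I * (a * Complex.cos θ + b * Complex.sin θ) : ℂ) ≠ 0 := by
      intro h
      rw [h, mul_zero] at hprod
      exact (mul_ne_zero h1 h2) hprod
    have hsum : (1 - A)⁻¹ + (1 - B)⁻¹ - 1 = (1 - A * B) / ((1 - A) * (1 - B)) := by
      field_simp; ring
    rw [hsum, hprod, hAB]
    push_cast
    field_simp
    linear_combination hR2c
  simp_rw [hpt]
  have hc1 : IntervalIntegrable (fun θ : ℝ => (1 - k₁ * Complex.exp (θ * Complex.I))⁻¹) volume
      (-Real.pi) Real.pi := by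
    apply Continuous.intervalIntegrable
    exact Continuous.inv₀ (by fun_prop) hne1
  have hc2 : IntervalIntegrable (fun θ : ℝ => (1 - k₂ * Complex.exp ((-θ : ℝ) * Complex.I))⁻¹) volume
      (-Real.pi) Real.pi := by
    apply Continuous.intervalIntegrable
    exact Continuous.inv₀ (by fun_prop) hne2
  rw [intervalIntegral.integral_const_mul, intervalIntegral.integral_sub (hc1.add hc2) (by simp),
    intervalIntegral.integral_add hc1 hc2, aux_mean hn1,
    intervalIntegral.integral_comp_neg (fun θ : ℝ => (1 - k₂ * Complex.exp (θ * Complex.I))⁻¹),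
    neg_neg, aux_mean hn2]
  simp
  field_simp
  ring

lemma aux_sqrt_bound (κ s : ℝ) (hκ : 0 ≤ κ) :
    κ ≤ (((κ : ℂ) ^ 2 - Complex.I * (s : ℂ)) ^ ((1 : ℂ) / 2)).re := by
  set w := (κ : ℂ) ^ 2 - Complex.I * (s : ℂ) with hw
  have hsq : (w ^ ((1:ℂ) / 2)) ^ 2 = w := by
    have := Complex.cpow_nat_inv_pow w (n := 2) two_ne_zero
    rw [one_div]; exact_mod_cast this
  have hre : 0 ≤ (w ^ ((1:ℂ) / 2)).re := by
    by_cases h0 : w = 0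
    · rw [h0, Complex.zero_cpow (by norm_num)]; simp
    · rw [Complex.cpow_def_of_ne_zero h0, Complex.exp_re]
      apply mul_nonneg (Real.exp_nonneg _)
      have : (Complex.log w * (1 / 2)).im = w.arg / 2 := by
        have : (1 / 2 : ℂ) = ((1 / 2 : ℝ) : ℂ) := by push_cast; rfl
        rw [this, Complex.im_mul_ofReal, Complex.log_im]; ring
      rw [this]
      apply Real.cos_nonneg_of_mem_Icc
      constructor <;> linarith [Complex.neg_pi_lt_arg w, Complex.arg_le_pi w]
  have h2 := congrArg Complex.re hsq
  have h3 : w.re = κ ^ 2 := by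
    rw [hw, ← Complex.ofReal_pow, Complex.sub_re, Complex.ofReal_re, Complex.I_mul_re]; simp
  rw [h3, sq, Complex.mul_re] at h2
  refine (sq_le_sq₀ hκ hre).mp ?_
  nlinarith [sq_nonneg (w ^ ((1:ℂ) / 2)).im]

lemma aux_lim (κ : ℝ) (hκ : 0 < κ) :
    Filter.Tendsto (fun s : ℝ => ((κ : ℂ) ^ 2 - Complex.I * (s : ℂ)) ^ ((1 : ℂ) / 2))
      (nhdsWithin 0 (Set.Ioi 0)) (nhds (κ : ℂ)) := by
  have h0 : ((κ : ℂ) ^ 2 - Complex.I * ((0:ℝ) : ℂ)) ^ ((1 : ℂ) / 2) = κ := by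
    have : ((1:ℂ) / 2) = ((2:ℕ) : ℂ)⁻¹ := by norm_num
    rw [this]
    simp only [Complex.ofReal_zero, mul_zero, sub_zero]
    rw [show (κ : ℂ) ^ 2 = ((κ ^ 2 : ℝ) : ℂ) by push_cast; rfl,
      show (((2:ℕ) : ℂ)⁻¹) = (((2:ℝ)⁻¹ : ℝ) : ℂ) by push_cast; rfl,
      ← Complex.ofReal_cpow (by positivity)]
    congr 1
    rw [← one_div, ← Real.sqrt_eq_rpow, Real.sqrt_sq hκ.le]
  have hc : ContinuousAt (fun s : ℝ => ((κ : ℂ) ^ 2 - Complex.I * (s : ℂ)) ^ ((1 : ℂ) / 2)) 0 := by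
    apply ContinuousAt.cpow (by fun_prop) continuousAt_const
    left
    rw [← Complex.ofReal_pow, Complex.sub_re, Complex.ofReal_re, Complex.I_mul_re]; simp; positivity
  have := hc.tendsto
  rw [h0] at this
  exact this.mono_left nhdsWithin_le_nhds

lemma aux_polar_int {f : ℝ × ℝ → ℂ} (h : IntegrableOn (fun p : ℝ × ℝ => p.1 • f (polarCoord.symm p))
    polarCoord.target) : Integrable f := by
  have key := integrableOn_image_iff_integrableOn_abs_det_fderiv_smul volume
    polarCoord.open_target.measurableSet
    (fun p _ => (hasFDerivAt_polarCoord_symm p).hasFDerivWithinAt) polarCoord.symm.injOn f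
  rw [polarCoord.symm_image_target_eq_source] at key
  rw [← integrableOn_univ, ← integrableOn_congr_set_ae polarCoord_source_ae_eq_univ, key]
  refine h.congr_fun ?_ polarCoord.open_target.measurableSet
  intro p hp
  have : 0 < p.1 := hp.1
  simp only [det_fderivPolarCoordSymm, abs_of_pos this]

/-- the limit integrand -/
noncomputable def auxF (a b z : ℝ) (p : ℝ × ℝ) : ℂ :=
  ((Real.sqrt (p.1 ^ 2 + p.2 ^ 2) : ℝ) : ℂ)⁻¹ *
    Complex.exp (-((Real.sqrt (p.1 ^ 2 + p.2 ^ 2) : ℝ) : ℂ) * z +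
      Complex.I * ((p.1 * a + p.2 * b : ℝ) : ℂ))

lemma auxF_polar (a b z : ℝ) (p : ℝ × ℝ) (hp : 0 < p.1) :
    p.1 • auxF a b z (polarCoord.symm p) =
      Complex.exp (-((z : ℂ) - Complex.I * ((a * Real.cos p.2 + b * Real.sin p.2 : ℝ) : ℂ)) * p.1) := by
  have h : Real.sqrt ((p.1 * Real.cos p.2) ^ 2 + (p.1 * Real.sin p.2) ^ 2) = p.1 := by
    rw [show (p.1 * Real.cos p.2) ^ 2 + (p.1 * Real.sin p.2) ^ 2
      = p.1 ^ 2 * (Real.cos p.2 ^ 2 + Real.sin p.2 ^ 2) by ring, Real.cos_sq_add_sin_sq, mul_one,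
      Real.sqrt_sq hp.le]
  have hp' : (p.1 : ℂ) ≠ 0 := by exact_mod_cast hp.ne'
  simp only [auxF, polarCoord_symm_apply, h, Complex.real_smul]
  rw [← mul_assoc, mul_inv_cancel₀ hp', one_mul]
  congr 1
  push_cast; ring

lemma aux_exp_int (a b z : ℝ) (hz : 0 < z) :
    IntegrableOn (fun p : ℝ × ℝ =>
      Complex.exp (-((z : ℂ) - Complex.I * ((a * Real.cos p.2 + b * Real.sin p.2 : ℝ) : ℂ)) * p.1))
      (Set.Ioi 0 ×ˢ Set.Ioo (-Real.pi) Real.pi) (volume.prod volume) := by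
  have hd : Integrable (fun p : ℝ × ℝ => Real.exp (-z * p.1) * (1:ℝ))
      ((volume.restrict (Set.Ioi 0)).prod (volume.restrict (Set.Ioo (-Real.pi) Real.pi))) := by
    apply Integrable.mul_prod (f := fun x => Real.exp (-z * x)) (g := fun _ => (1:ℝ))
    · exact exp_neg_integrableOn_Ioi 0 hz
    · exact integrable_const _
  rw [IntegrableOn, ← Measure.prod_restrict]
  refine hd.mono' ?_ ?_
  · apply Continuous.aestronglyMeasurable
    fun_prop
  · filter_upwards with p
    rw [Complex.norm_exp, mul_one]
    apply le_of_eq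
    congr 1
    rw [Complex.re_mul_ofReal]
    simp

lemma auxF_integrable (a b z : ℝ) (hz : 0 < z) : Integrable (auxF a b z) := by
  apply aux_polar_int
  refine (aux_exp_int a b z hz).congr_fun ?_ polarCoord.open_target.measurableSet
  intro p hp
  exact (auxF_polar a b z p hp.1).symm

lemma auxF_integral (a b z : ℝ) (hz : 0 < z) :
    ∫ p, auxF a b z p = ((2 * Real.pi / Real.sqrt (a ^ 2 + b ^ 2 + z ^ 2) : ℝ) : ℂ) := by
  rw [← integral_comp_polarCoord_symm,
    setIntegral_congr_fun polarCoord.open_target.measurableSet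
      (fun p hp => auxF_polar a b z p hp.1), polarCoord_target, Measure.volume_eq_prod,
    ← setIntegral_prod_swap]
  have hs := (aux_exp_int a b z hz).swap
  rw [show (∫ p in Set.Ioo (-Real.pi) Real.pi ×ˢ Set.Ioi (0:ℝ), Complex.exp (-((z : ℂ) - Complex.I * ((a * Real.cos p.swap.2 + b * Real.sin p.swap.2 : ℝ) : ℂ)) * p.swap.1) ∂(volume.prod volume)) = _ from setIntegral_prod _ hs,
    ← aux_angle a b z hz, intervalIntegral.integral_of_le (by linarith [Real.pi_pos]),
    integral_Ioc_eq_integral_Ioo]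
  refine setIntegral_congr_fun measurableSet_Ioo ?_
  intro θ _
  simp only [Prod.swap_prod_mk, Prod.fst_swap, Prod.snd_swap]
  rw [integral_exp_mul_complex_Ioi (by simp [hz])]
  rw [Complex.ofReal_zero, mul_zero, Complex.exp_zero, neg_div_neg_eq, one_div]

/-- The half-space Green's function `G_s` converges to `(2/(1+μ)) G₀` as the
soil conductivity parameter `s` tends to zero from above, where
`G₀(x,y) = 1/(4π‖x-y‖)` is the free-space Laplace Green's function. Here
`γ_s(κ)` is the principal complex square root of `κ² - i s`. In particular,
for `μ = 1` the limit is the free-space Laplace Green's function. -/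
theorem halfspace_green_tendsto_laplace_green
    (x y : EuclideanSpace ℝ (Fin 3)) (hx : 0 < x 2) (hy : y 2 < 0)
    (μ : ℝ) (hμ : 1 ≤ μ)
    (G : ℝ → ℂ)
    (hG : ∀ s : ℝ, 0 < s → G s =
      ((1 / (2 * Real.pi) ^ 2 : ℝ) : ℂ) *
        ∫ p : ℝ × ℝ,
          (((Real.sqrt (p.1 ^ 2 + p.2 ^ 2) : ℂ) ^ 2 - Complex.I * (s : ℂ)) ^ ((1 : ℂ) / 2)
              + (μ : ℂ) * (Real.sqrt (p.1 ^ 2 + p.2 ^ 2) : ℂ))⁻¹ *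
            Complex.exp
              (-(((Real.sqrt (p.1 ^ 2 + p.2 ^ 2) : ℂ) ^ 2 - Complex.I * (s : ℂ)) ^ ((1 : ℂ) / 2))
                  * ((x 2 : ℝ) : ℂ)
                + ((Real.sqrt (p.1 ^ 2 + p.2 ^ 2) * y 2 : ℝ) : ℂ)
                + Complex.I * ((p.1 * (x 0 - y 0) + p.2 * (x 1 - y 1) : ℝ) : ℂ))) :
    Filter.Tendsto G (nhdsWithin 0 (Set.Ioi 0))
      (nhds (((2 / (1 + μ)) * (1 / (4 * Real.pi * ‖x - y‖)) : ℝ) : ℂ)) := by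
  have hz : 0 < x 2 - y 2 := by linarith
  have hμ0 : 0 < 1 + μ := by linarith
  have hμc : (1 : ℂ) + μ ≠ 0 := by exact_mod_cast hμ0.ne'
  have hnorm : ‖x - y‖ = Real.sqrt ((x 0 - y 0) ^ 2 + (x 1 - y 1) ^ 2 + (x 2 - y 2) ^ 2) := by
    rw [EuclideanSpace.norm_eq, Fin.sum_univ_three]; simp
  have hRpos : 0 < Real.sqrt ((x 0 - y 0) ^ 2 + (x 1 - y 1) ^ 2 + (x 2 - y 2) ^ 2) :=
    Real.sqrt_pos.mpr (by positivity)
  have hval : (((2 / (1 + μ)) * (1 / (4 * Real.pi * ‖x - y‖)) : ℝ) : ℂ) =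
      ((1 / (2 * Real.pi) ^ 2 : ℝ) : ℂ) *
        ∫ p, (1 + (μ : ℂ))⁻¹ * auxF (x 0 - y 0) (x 1 - y 1) (x 2 - y 2) p := by
    rw [integral_const_mul, auxF_integral _ _ _ hz, hnorm]
    rw [show (1 + (μ : ℂ))⁻¹ = (((1 + μ)⁻¹ : ℝ) : ℂ) by push_cast; rfl,
      ← Complex.ofReal_mul, ← Complex.ofReal_mul]
    congr 1
    have := Real.pi_pos
    field_simp
    norm_num
  have hkpos : ∀ᵐ p : ℝ × ℝ, 0 < Real.sqrt (p.1 ^ 2 + p.2 ^ 2) := by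
    have : ∀ᵐ p : ℝ × ℝ, p ≠ 0 := by simp [ae_iff]
    filter_upwards [this] with p hp
    apply Real.sqrt_pos.mpr
    by_contra h
    apply hp
    have h1 : p.1 = 0 := by nlinarith [sq_nonneg p.1, sq_nonneg p.2]
    have h2 : p.2 = 0 := by nlinarith [sq_nonneg p.1, sq_nonneg p.2]
    exact Prod.ext h1 h2
  rw [hval]
  refine Filter.Tendsto.congr' (Filter.EventuallyEq.symm
    (Filter.eventuallyEq_of_mem self_mem_nhdsWithin (fun s hs => hG s hs))) ?_
  apply Filter.Tendsto.const_mul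
  refine tendsto_integral_filter_of_dominated_convergence
    (fun p => (1 + μ)⁻¹ * ‖auxF (x 0 - y 0) (x 1 - y 1) (x 2 - y 2) p‖) ?_ ?_
    ((auxF_integrable _ _ _ hz).norm.const_mul _) ?_
  · filter_upwards with s
    apply Measurable.aestronglyMeasurable
    fun_prop
  · filter_upwards with s
    filter_upwards [hkpos] with p hp
    set κ := Real.sqrt (p.1 ^ 2 + p.2 ^ 2) with hκ
    have hb := aux_sqrt_bound κ s hp.le
    set g := ((κ : ℂ) ^ 2 - Complex.I * (s : ℂ)) ^ ((1 : ℂ) / 2)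
    rw [auxF, ← hκ, norm_mul, norm_mul, norm_inv, norm_inv, ← mul_assoc, ← mul_inv,
      Complex.norm_exp, Complex.norm_exp, Complex.norm_real, Real.norm_of_nonneg hp.le]
    apply mul_le_mul _ _ (Real.exp_nonneg _) (by positivity)
    · apply inv_anti₀ (by positivity)
      refine le_trans ?_ (Complex.re_le_norm _)
      rw [Complex.add_re, ← Complex.ofReal_mul, Complex.ofReal_re]
      linarith
    · apply Real.exp_le_exp.mpr
      rw [Complex.add_re, Complex.add_re, Complex.add_re, Complex.re_mul_ofReal,
        Complex.re_mul_ofReal, Complex.I_re, Complex.re_mul_ofReal,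
        Complex.ofReal_re, Complex.neg_re, Complex.neg_re, Complex.ofReal_re]
      nlinarith
  · filter_upwards [hkpos] with p hp
    have hl := aux_lim _ hp
    have hp' : ((Real.sqrt (p.1 ^ 2 + p.2 ^ 2) : ℝ) : ℂ) ≠ 0 := by exact_mod_cast hp.ne'
    have hk : ((Real.sqrt (p.1 ^ 2 + p.2 ^ 2) : ℝ) : ℂ)
        + (μ : ℂ) * ((Real.sqrt (p.1 ^ 2 + p.2 ^ 2) : ℝ) : ℂ) ≠ 0 := by
      rw [← one_add_mul]; exact mul_ne_zero hμc hp'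
    have := ((hl.add_const ((μ : ℂ) * (Real.sqrt (p.1 ^ 2 + p.2 ^ 2) : ℂ))).inv₀ hk).mul
      ((((hl.neg.mul_const ((x 2 : ℝ) : ℂ)).add_const
        ((Real.sqrt (p.1 ^ 2 + p.2 ^ 2) * y 2 : ℝ) : ℂ)).add_const
        (Complex.I * ((p.1 * (x 0 - y 0) + p.2 * (x 1 - y 1) : ℝ) : ℂ))).cexp)
    convert this using 2
    rw [auxF, ← one_add_mul, mul_inv, mul_assoc]
    congr 3
    push_cast; ring
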